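/- arXiv:1106.5837 — 8 statements merged into one kernel-verified Lean document; each statement's English description precedes it below -/
import Mathlib

section
/- Deterministic ℓ₂ estimation error bound (Theorem 1). Assume S ≠ ∅, Ŝ ≠ ∅, 1 ≤ max(q_R, ŝ) ≤ p, and κ_n + λ/n > 0. Then ‖β̂ − β‖₂ ≤ (q_R^{1/2}/(κ_n + λ n⁻¹)) · { 4[1 + (ŝ/(4s))^{1/2}] · ‖Xᵀε‖_∞/n + 2 max_{j∈S}|β_j| · λ/n + [ (2 c₂⁻¹ + 1)/log(τ⁻¹) + c₃⁻¹ ] · (ρ₁ + ρ₂)/n }. -/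
/-- The support of a coefficient vector: `S = {j : β_j ≠ 0}`. -/
noncomputable def supp {p : ℕ} (β : Fin p → ℝ) : Finset (Fin p) :=
  Finset.univ.filter fun j => β j ≠ 0

/-- The active groups: `R = {k : β_{G_k} ≠ 0}`. -/
noncomputable def activeGroups {p m : ℕ} (G : Fin m → Finset (Fin p)) (β : Fin p → ℝ) :
    Finset (Fin m) :=
  Finset.univ.filter fun k => ∃ j ∈ G k, β j ≠ 0

/-- The penalized least-squares objective
`V_τ(b) = ‖y − Xb‖₂² + λ‖b‖₂² + ρ₁ Σ_j log(1+τ⁻¹|b_j|)/log(1+τ⁻¹)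
  + ρ₂ Σ_k √q_k log(1+τ⁻¹‖b_{G_k}‖₂)/log(1+τ⁻¹)`. -/
noncomputable def Vtau {n p m : ℕ} (y : Fin n → ℝ) (X : Matrix (Fin n) (Fin p) ℝ)
    (G : Fin m → Finset (Fin p)) (lam ρ1 ρ2 τ : ℝ) (b : Fin p → ℝ) : ℝ :=
  (∑ i, (y i - ∑ j, X i j * b j) ^ 2) + lam * ∑ j, (b j) ^ 2
    + ρ1 * ∑ j, Real.log (1 + τ⁻¹ * |b j|) / Real.log (1 + τ⁻¹)
    + ρ2 * ∑ k, Real.sqrt ((G k).card) *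
        (Real.log (1 + τ⁻¹ * Real.sqrt (∑ j ∈ G k, (b j) ^ 2)) / Real.log (1 + τ⁻¹))

/-- Minkowski's inequality for a finite sum of squares. -/
lemma sqrt_sum_sq_le_add {ι : Type*} (T : Finset ι) (a b : ι → ℝ) :
    Real.sqrt (∑ j ∈ T, a j ^ 2) ≤
      Real.sqrt (∑ j ∈ T, b j ^ 2) + Real.sqrt (∑ j ∈ T, (b j - a j) ^ 2) := by
  have hb : 0 ≤ ∑ j ∈ T, b j ^ 2 := Finset.sum_nonneg fun j _ => sq_nonneg _
  have hw : 0 ≤ ∑ j ∈ T, (b j - a j) ^ 2 := Finset.sum_nonneg fun j _ => sq_nonneg _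
  rw [Real.sqrt_le_left (by positivity)]
  have hcs := Real.sum_mul_le_sqrt_mul_sqrt T b (fun j => a j - b j)
  have hswap : ∑ j ∈ T, (a j - b j) ^ 2 = ∑ j ∈ T, (b j - a j) ^ 2 :=
    Finset.sum_congr rfl fun j _ => by ring
  have hexp : ∑ j ∈ T, a j ^ 2 = ∑ j ∈ T, b j ^ 2 + 2 * ∑ j ∈ T, b j * (a j - b j)
      + ∑ j ∈ T, (b j - a j) ^ 2 := by
    rw [Finset.mul_sum, ← Finset.sum_add_distrib, ← Finset.sum_add_distrib]
    exact Finset.sum_congr rfl fun j _ => by ring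
  rw [hswap] at hcs
  rw [hexp, add_sq, Real.sq_sqrt hb, Real.sq_sqrt hw]
  linarith

/-- The `ℓ₁` norm on a finite set is at most the square root of its size times the `ℓ₂` norm. -/
lemma sum_abs_le_sqrt_card_mul {ι : Type*} [Fintype ι] (T : Finset ι) (w : ι → ℝ) :
    ∑ j ∈ T, |w j| ≤ Real.sqrt T.card * Real.sqrt (∑ j, w j ^ 2) := by
  have h := Real.sum_mul_le_sqrt_mul_sqrt T (fun _ => 1) (fun j => |w j|)
  simp only [one_mul, one_pow, sq_abs, Finset.sum_const, nsmul_eq_mul, mul_one] at h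
  refine h.trans ?_
  gcongr
  exact Finset.subset_univ T

/-- Cauchy–Schwarz for the `√|G_k|`-weighted sum of the `ℓ₂` norms over disjoint groups. -/
lemma sum_sqrt_card_mul_le {ι κ : Type*} [Fintype ι] [DecidableEq ι] (R : Finset κ)
    (G : κ → Finset ι) (hG : ∀ k k', k ≠ k' → Disjoint (G k) (G k')) (w : ι → ℝ) :
    ∑ k ∈ R, Real.sqrt (G k).card * Real.sqrt (∑ j ∈ G k, w j ^ 2) ≤
      Real.sqrt (R.biUnion G).card * Real.sqrt (∑ j, w j ^ 2) := by
  have h := Real.sum_mul_le_sqrt_mul_sqrt R (fun k => Real.sqrt (G k).card)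
    (fun k => Real.sqrt (∑ j ∈ G k, w j ^ 2))
  have hdisj : Set.PairwiseDisjoint (R : Set κ) G := fun k _ k' _ hk => hG k k' hk
  refine h.trans ?_
  have h1 : ∑ k ∈ R, Real.sqrt (G k).card ^ 2 = ((R.biUnion G).card : ℝ) := by
    rw [Finset.card_biUnion hdisj]
    push_cast
    exact Finset.sum_congr rfl fun k _ => Real.sq_sqrt (by positivity)
  have h2 : ∑ k ∈ R, Real.sqrt (∑ j ∈ G k, w j ^ 2) ^ 2 = ∑ j ∈ R.biUnion G, w j ^ 2 := by
    rw [Finset.sum_biUnion hdisj]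
    exact Finset.sum_congr rfl fun k _ =>
      Real.sq_sqrt (Finset.sum_nonneg fun j _ => sq_nonneg _)
  rw [h1, h2]
  gcongr
  exact Finset.subset_univ _

/-- The increment of the normalized log penalty from `b` to `a` when `a` is bounded below by `c₃`
and `b` either vanishes or is bounded below by `c₂`. -/
lemma logPenalty_sub_le {τ a b w c₂ c₃ : ℝ} (hτ : τ ∈ Set.Ioo (0 : ℝ) 1)
    (hc₂ : 0 < c₂) (hc₃ : 0 < c₃) (hw : 0 ≤ w) (ha : c₃ ≤ a) (hb : b = 0 ∨ c₂ ≤ b)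
    (hab : a ≤ b + w) :
    Real.log (1 + τ⁻¹ * a) / Real.log (1 + τ⁻¹) - Real.log (1 + τ⁻¹ * b) / Real.log (1 + τ⁻¹) ≤
      ((2 * c₂⁻¹ + 1) / Real.log τ⁻¹ + c₃⁻¹) * w := by
  obtain ⟨hτ0, hτ1⟩ := hτ
  have hti : 1 < τ⁻¹ := (one_lt_inv₀ hτ0).2 hτ1
  have hl : 0 < Real.log τ⁻¹ := Real.log_pos hti
  have hL : Real.log τ⁻¹ ≤ Real.log (1 + τ⁻¹) := Real.log_le_log (by linarith) (by linarith)
  have hL0 : 0 < Real.log (1 + τ⁻¹) := hl.trans_le hL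
  have ha0 : 0 < a := hc₃.trans_le ha
  have h2 : 0 ≤ c₂⁻¹ * w := by positivity
  rcases hb with rfl | hb
  · have haw : a ≤ w := by linarith
    have hlog : Real.log (1 + τ⁻¹ * a) ≤ Real.log (1 + τ⁻¹) + a := by
      have h1 : 1 + τ⁻¹ * a ≤ (1 + τ⁻¹) * (1 + a) := by nlinarith
      have h3 := Real.log_le_log (by positivity) h1
      rw [Real.log_mul (by positivity) (by positivity)] at h3
      have := Real.log_le_sub_one_of_pos (show 0 < 1 + a by linarith)
      linarith
    have hone : 1 ≤ c₃⁻¹ * w := by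
      rw [inv_mul_eq_div, le_div_iff₀ hc₃]
      linarith
    calc _ = Real.log (1 + τ⁻¹ * a) / Real.log (1 + τ⁻¹) := by simp
      _ ≤ (Real.log (1 + τ⁻¹) + a) / Real.log (1 + τ⁻¹) := by gcongr
      _ = 1 + a / Real.log (1 + τ⁻¹) := by
          rw [add_div, div_self hL0.ne']
      _ ≤ c₃⁻¹ * w + (2 * (c₂⁻¹ * w) + w) / Real.log τ⁻¹ := by
          gcongr
          linarith
      _ = _ := by ring
  · have hb0 : 0 < b := hc₂.trans_le hb
    have hlog : Real.log (1 + τ⁻¹ * a) - Real.log (1 + τ⁻¹ * b) ≤ c₂⁻¹ * w := by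
      rw [← Real.log_div (by positivity) (by positivity)]
      refine (Real.log_le_sub_one_of_pos (by positivity)).trans ?_
      have h1 : (1 + τ⁻¹ * a) / (1 + τ⁻¹ * b) - 1 = (a - b) / (τ + b) := by
        field_simp
        ring
      rw [h1, inv_mul_eq_div]
      calc (a - b) / (τ + b) ≤ w / (τ + b) := by gcongr; linarith
        _ ≤ w / c₂ := by gcongr; linarith
    calc _ = (Real.log (1 + τ⁻¹ * a) - Real.log (1 + τ⁻¹ * b)) / Real.log (1 + τ⁻¹) := by ring
      _ ≤ (c₂⁻¹ * w) / Real.log (1 + τ⁻¹) := by gcongr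
      _ ≤ (2 * (c₂⁻¹ * w) + w) / Real.log τ⁻¹ := by
          gcongr
          linarith
      _ ≤ (2 * (c₂⁻¹ * w) + w) / Real.log τ⁻¹ + c₃⁻¹ * w :=
          le_add_of_nonneg_right (by positivity)
      _ = _ := by ring

/-- The normalized log penalty is nonnegative. -/
lemma logPenalty_nonneg {τ t : ℝ} (hτ : 0 < τ) (ht : 0 ≤ t) :
    0 ≤ Real.log (1 + τ⁻¹ * t) / Real.log (1 + τ⁻¹) := by
  have h : 0 ≤ τ⁻¹ := by positivity
  exact div_nonneg (Real.log_nonneg (by nlinarith)) (Real.log_nonneg (by linarith))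

/-- A lower bound of a quadratic form on the unit sphere extends to all vectors by scaling. -/
lemma mul_sum_sq_le_of_isLeast {n p : ℕ} (X : Matrix (Fin n) (Fin p) ℝ) {c : ℝ}
    (hc : IsLeast {r : ℝ | ∃ u : Fin p → ℝ, (∑ j, (u j) ^ 2) = 1 ∧
            r = ∑ i, (∑ j, X i j * u j) ^ 2} c) (w : Fin p → ℝ) :
    c * ∑ j, w j ^ 2 ≤ ∑ i, (∑ j, X i j * w j) ^ 2 := by
  have hW : 0 ≤ ∑ j, w j ^ 2 := Finset.sum_nonneg fun j _ => sq_nonneg _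
  rcases hW.eq_or_lt with h0 | hpos
  · rw [← h0, mul_zero]
    exact Finset.sum_nonneg fun i _ => sq_nonneg _
  have hs := Real.sq_sqrt hW
  have hs0 : Real.sqrt (∑ j, w j ^ 2) ≠ 0 := (Real.sqrt_pos.2 hpos).ne'
  set N := Real.sqrt (∑ j, w j ^ 2)
  have h := hc.2 ⟨fun j => w j / N, by
    simp only [div_pow]
    rw [← Finset.sum_div, ← hs, div_self (pow_ne_zero 2 hs0)], rfl⟩
  have hscale : ∑ i, (∑ j, X i j * (w j / N)) ^ 2 = (∑ i, (∑ j, X i j * w j) ^ 2) / N ^ 2 := by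
    rw [Finset.sum_div]
    refine Finset.sum_congr rfl fun i _ => ?_
    rw [← div_pow, Finset.sum_div]
    simp only [mul_div_assoc]
  rw [hscale, le_div_iff₀ (by positivity), hs] at h
  exact h

/-- The increment of the `ℓ₁`-type log penalty between two coefficient vectors. -/
lemma sum_logPenalty_sub_le {p : ℕ} {β βhat : Fin p → ℝ} {τ c₂ c₃ : ℝ}
    (hτ : τ ∈ Set.Ioo (0 : ℝ) 1) (hc₂ : 0 < c₂) (hc₃ : 0 < c₃)
    (h₂ : ∀ j, βhat j ≠ 0 → c₂ ≤ |βhat j|) (h₃ : ∀ j, β j ≠ 0 → c₃ ≤ |β j|) :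
    ∑ j, Real.log (1 + τ⁻¹ * |β j|) / Real.log (1 + τ⁻¹)
        - ∑ j, Real.log (1 + τ⁻¹ * |βhat j|) / Real.log (1 + τ⁻¹) ≤
      ((2 * c₂⁻¹ + 1) / Real.log τ⁻¹ + c₃⁻¹) * ∑ j ∈ supp β, |βhat j - β j| := by
  rw [← Finset.sum_sub_distrib, Finset.mul_sum, supp, Finset.sum_filter]
  refine Finset.sum_le_sum fun j _ => ?_
  split_ifs with hj
  · refine logPenalty_sub_le hτ hc₂ hc₃ (abs_nonneg _) (h₃ j hj) ?_ ?_
    · by_cases h0 : βhat j = 0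
      · exact Or.inl (by simp [h0])
      · exact Or.inr (h₂ j h0)
    · have := abs_sub_abs_le_abs_sub (β j) (βhat j)
      rw [abs_sub_comm] at this
      linarith
  · rw [not_not] at hj
    simpa [hj] using logPenalty_nonneg hτ.1 (abs_nonneg (βhat j))

/-- The increment of the group log penalty between two coefficient vectors. -/
lemma sum_group_logPenalty_sub_le {p m : ℕ} {β βhat : Fin p → ℝ} {τ c₂ c₃ : ℝ}
    (G : Fin m → Finset (Fin p))
    (hτ : τ ∈ Set.Ioo (0 : ℝ) 1) (hc₂ : 0 < c₂) (hc₃ : 0 < c₃)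
    (h₂ : ∀ j, βhat j ≠ 0 → c₂ ≤ |βhat j|) (h₃ : ∀ j, β j ≠ 0 → c₃ ≤ |β j|) :
    ∑ k, Real.sqrt ((G k).card) *
          (Real.log (1 + τ⁻¹ * Real.sqrt (∑ j ∈ G k, (β j) ^ 2)) / Real.log (1 + τ⁻¹))
        - ∑ k, Real.sqrt ((G k).card) *
          (Real.log (1 + τ⁻¹ * Real.sqrt (∑ j ∈ G k, (βhat j) ^ 2)) / Real.log (1 + τ⁻¹)) ≤
      ((2 * c₂⁻¹ + 1) / Real.log τ⁻¹ + c₃⁻¹) * ∑ k ∈ activeGroups G β,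
        Real.sqrt (G k).card * Real.sqrt (∑ j ∈ G k, (βhat j - β j) ^ 2) := by
  have abs_le_norm (v : Fin p → ℝ) (k : Fin m) (j : Fin p) (hj : j ∈ G k) :
      |v j| ≤ Real.sqrt (∑ j ∈ G k, v j ^ 2) :=
    Real.abs_le_sqrt (Finset.single_le_sum (f := fun j => v j ^ 2) (fun i _ => sq_nonneg _) hj)
  rw [← Finset.sum_sub_distrib, Finset.mul_sum, activeGroups, Finset.sum_filter]
  refine Finset.sum_le_sum fun k _ => ?_
  rw [← mul_sub]
  split_ifs with hk
  · obtain ⟨j, hj, hj0⟩ := hk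
    rw [mul_left_comm]
    refine mul_le_mul_of_nonneg_left ?_ (Real.sqrt_nonneg _)
    refine logPenalty_sub_le hτ hc₂ hc₃ (Real.sqrt_nonneg _)
      ((h₃ j hj0).trans (abs_le_norm β k j hj)) ?_ (sqrt_sum_sq_le_add _ _ _)
    by_cases h0 : ∃ i ∈ G k, βhat i ≠ 0
    · obtain ⟨i, hi, hi0⟩ := h0
      exact Or.inr ((h₂ i hi0).trans (abs_le_norm βhat k i hi))
    · push Not at h0
      left
      rw [Finset.sum_eq_zero fun i hi => by rw [h0 i hi]; norm_num, Real.sqrt_zero]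
  · push Not at hk
    have hz : ∑ j ∈ G k, β j ^ 2 = 0 :=
      Finset.sum_eq_zero fun i hi => by rw [hk i hi]; norm_num
    have := logPenalty_nonneg hτ.1 (Real.sqrt_nonneg (∑ j ∈ G k, βhat j ^ 2))
    rw [hz, Real.sqrt_zero, mul_zero, add_zero, Real.log_one, zero_div, zero_sub]
    exact mul_nonpos_of_nonneg_of_nonpos (Real.sqrt_nonneg _) (by linarith)

lemma sqrt_eq_two_mul_sqrt_mul_sqrt_div (t : ℝ) {s : ℝ} (hs : 0 < s) :
    Real.sqrt t = 2 * (Real.sqrt s * Real.sqrt (t / (4 * s))) := by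
  have h2 : (2 : ℝ) = Real.sqrt 4 := by
    rw [show (4 : ℝ) = 2 ^ 2 by norm_num, Real.sqrt_sq zero_le_two]
  rw [← Real.sqrt_mul hs.le, h2, ← Real.sqrt_mul zero_le_four, ← mul_assoc,
    mul_div_cancel₀ _ (by positivity)]

/-- Solving a quadratic inequality `n D W² ≤ Q (a M + b l + K ρ) W` for `W`. -/
lemma le_div_mul_of_mul_sq_le {n D W Q a M b l K ρ : ℝ} (hn : 0 < n) (hD : 0 < D)
    (hQ : 0 ≤ Q) (hE : 0 ≤ a * M + b * l + K * ρ)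
    (h : n * D * W ^ 2 ≤ Q * (a * M + b * l + K * ρ) * W) :
    W ≤ Q / D * (a * (M / n) + b * (l / n) + K * (ρ / n)) := by
  have heq : Q / D * (a * (M / n) + b * (l / n) + K * (ρ / n)) =
      Q * (a * M + b * l + K * ρ) / (n * D) := by
    field_simp
  rw [heq]
  rcases le_or_gt W 0 with hW | hW
  · exact hW.trans (by positivity)
  · rw [le_div_iff₀ (by positivity)]
    refine le_of_mul_le_mul_right ?_ hW
    linarith

/-- **Deterministic ℓ₂ estimation error bound (Theorem 1).**
Let `β̂` minimize `V_τ`, `w = β̂ − β`, `ε = y − Xβ`, `S ≠ ∅`, `Ŝ ≠ ∅`,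
`1 ≤ max(q_R, ŝ) ≤ p` and `κ_n + λ/n > 0`, where `κ_n = n⁻¹ min_{‖u‖₂=1} uᵀXᵀXu`. Then
`‖β̂ − β‖₂ ≤ (q_R^{1/2}/(κ_n + λn⁻¹)) · {4[1 + (ŝ/(4s))^{1/2}]‖Xᵀε‖_∞/n
  + 2 max_{j∈S}|β_j| λ/n + [(2c₂⁻¹ + 1)/log(τ⁻¹) + c₃⁻¹](ρ₁+ρ₂)/n}`. -/
theorem deterministic_l2_error_bound {n p m : ℕ}
    (hn : 1 ≤ n) (hp : 1 ≤ p) (hm : 1 ≤ m)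
    (y : Fin n → ℝ) (X : Matrix (Fin n) (Fin p) ℝ) (β : Fin p → ℝ)
    (ε : Fin n → ℝ) (hε : ∀ i, ε i = y i - ∑ j, X i j * β j)
    (G : Fin m → Finset (Fin p))
    (hGne : ∀ k, (G k).Nonempty)
    (hGdisj : ∀ k k', k ≠ k' → Disjoint (G k) (G k'))
    (hGcover : ∀ j, ∃ k, j ∈ G k)
    (lam ρ1 ρ2 τ : ℝ) (hlam : 0 ≤ lam) (hρ1 : 0 ≤ ρ1) (hρ2 : 0 ≤ ρ2)
    (hτ : τ ∈ Set.Ioo (0 : ℝ) 1)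
    (βhat : Fin p → ℝ)
    (hmin : ∀ b : Fin p → ℝ, Vtau y X G lam ρ1 ρ2 τ βhat ≤ Vtau y X G lam ρ1 ρ2 τ b)
    (hS : (supp β).Nonempty) (hShat : (supp βhat).Nonempty)
    (hmax1 : 1 ≤ max ((activeGroups G β).biUnion G).card (supp βhat).card)
    (hmaxp : max ((activeGroups G β).biUnion G).card (supp βhat).card ≤ p)
    (κ : ℝ)
    (hκ : IsLeast {r : ℝ | ∃ u : Fin p → ℝ, (∑ j, (u j) ^ 2) = 1 ∧
            r = ∑ i, (∑ j, X i j * u j) ^ 2} ((n : ℝ) * κ))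
    (hpos : 0 < κ + lam * (n : ℝ)⁻¹) :
    Real.sqrt (∑ j, (βhat j - β j) ^ 2)
      ≤ Real.sqrt (((activeGroups G β).biUnion G).card) / (κ + lam * (n : ℝ)⁻¹) *
          (4 * (1 + Real.sqrt (((supp βhat).card : ℝ) / (4 * (supp β).card))) *
              ((Finset.univ.sup' ⟨hS.choose, Finset.mem_univ _⟩
                  fun j => |∑ i, X i j * ε i|) / n)
            + 2 * ((supp β).sup' hS fun j => |β j|) * (lam / n)
            + ((2 * ((supp βhat).inf' hShat fun j => |βhat j|)⁻¹ + 1) / Real.log τ⁻¹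
                + ((supp β).inf' hS fun j => |β j|)⁻¹) * ((ρ1 + ρ2) / n)) := by
  have hn0 : (0 : ℝ) < n := by exact_mod_cast hn
  have hs0 : (0 : ℝ) < (supp β).card := by exact_mod_cast hS.card_pos
  set M := Finset.univ.sup' ⟨hS.choose, Finset.mem_univ _⟩ fun j => |∑ i, X i j * ε i|
  set B := (supp β).sup' hS fun j => |β j|
  set c₂ := (supp βhat).inf' hShat fun j => |βhat j|
  set c₃ := (supp β).inf' hS fun j => |β j|
  have hM (j : Fin p) : |∑ i, X i j * ε i| ≤ M :=
    Finset.le_sup' (fun j => |∑ i, X i j * ε i|) (Finset.mem_univ j)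
  have hB (j : Fin p) (hj : j ∈ supp β) : |β j| ≤ B := Finset.le_sup' (fun j => |β j|) hj
  have h₂ (j : Fin p) (hj : βhat j ≠ 0) : c₂ ≤ |βhat j| :=
    Finset.inf'_le (fun j => |βhat j|) (by simp [supp, hj])
  have h₃ (j : Fin p) (hj : β j ≠ 0) : c₃ ≤ |β j| :=
    Finset.inf'_le (fun j => |β j|) (by simp [supp, hj])
  have hc₂ : 0 < c₂ := (Finset.lt_inf'_iff _).2 fun j hj => abs_pos.2 (by simpa [supp] using hj)
  have hc₃ : 0 < c₃ := (Finset.lt_inf'_iff _).2 fun j hj => abs_pos.2 (by simpa [supp] using hj)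
  have hM0 : 0 ≤ M := (abs_nonneg _).trans (hM hS.choose)
  have hB0 : 0 ≤ B := (abs_nonneg _).trans (hB _ hS.choose_spec)
  have hl : 0 < Real.log τ⁻¹ := Real.log_pos ((one_lt_inv₀ hτ.1).2 hτ.2)
  set K := (2 * c₂⁻¹ + 1) / Real.log τ⁻¹ + c₃⁻¹ with hKdef
  have hK0 : 0 ≤ K := by positivity
  set w : Fin p → ℝ := fun j => βhat j - β j with hwdef
  set W := Real.sqrt (∑ j, w j ^ 2)
  have hW0 : 0 ≤ W := Real.sqrt_nonneg _
  have hWsq : ∑ j, w j ^ 2 = W ^ 2 :=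
    (Real.sq_sqrt (Finset.sum_nonneg fun j _ => sq_nonneg _)).symm
  set Q := Real.sqrt (((activeGroups G β).biUnion G).card)
  have hQ0 : 0 ≤ Q := Real.sqrt_nonneg _
  have hsQ : Real.sqrt (supp β).card ≤ Q := by
    refine Real.sqrt_le_sqrt (Nat.cast_le.2 (Finset.card_le_card fun j hj => ?_))
    obtain ⟨k, hk⟩ := hGcover j
    simp only [supp, Finset.mem_filter, Finset.mem_univ, true_and] at hj
    exact Finset.mem_biUnion.2 ⟨k, by simpa [activeGroups] using ⟨j, hk, hj⟩, hk⟩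
  have hXw : (n : ℝ) * κ * W ^ 2 ≤ ∑ i, (∑ j, X i j * w j) ^ 2 := by
    rw [← hWsq]
    exact mul_sum_sq_le_of_isLeast X hκ w
  -- the basic inequality
  have hpen₁ := sum_logPenalty_sub_le hτ hc₂ hc₃ h₂ h₃
  have hpen₂ := sum_group_logPenalty_sub_le G hτ hc₂ hc₃ h₂ h₃
  rw [← hKdef] at hpen₁ hpen₂
  have hbasic := hmin β
  have hfit : ∑ i, (y i - ∑ j, X i j * βhat j) ^ 2 = ∑ i, (y i - ∑ j, X i j * β j) ^ 2
      - 2 * ∑ j, (∑ i, X i j * ε i) * w j + ∑ i, (∑ j, X i j * w j) ^ 2 := by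
    have hcross : ∑ j, (∑ i, X i j * ε i) * w j = ∑ i, ε i * ∑ j, X i j * w j := by
      simp only [Finset.sum_mul, Finset.mul_sum]
      rw [Finset.sum_comm]
      exact Finset.sum_congr rfl fun i _ => Finset.sum_congr rfl fun j _ => by ring
    rw [hcross, Finset.mul_sum, ← Finset.sum_sub_distrib, ← Finset.sum_add_distrib]
    refine Finset.sum_congr rfl fun i _ => ?_
    have hi : ∑ j, X i j * βhat j = ∑ j, X i j * β j + ∑ j, X i j * w j := by
      rw [← Finset.sum_add_distrib]
      exact Finset.sum_congr rfl fun j _ => by simp only [hwdef]; ring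
    rw [hi, hε i]
    ring
  have hridge : ∑ j, βhat j ^ 2 = ∑ j, β j ^ 2 + 2 * ∑ j, β j * w j + W ^ 2 := by
    rw [← hWsq, Finset.mul_sum, ← Finset.sum_add_distrib, ← Finset.sum_add_distrib]
    exact Finset.sum_congr rfl fun j _ => by simp only [hwdef]; ring
  unfold Vtau at hbasic
  rw [hfit, hridge] at hbasic
  -- bounds of the noise and ridge terms
  have hs := sum_abs_le_sqrt_card_mul (supp β) w
  have hnoise : ∑ j, (∑ i, X i j * ε i) * w j ≤
      M * (Real.sqrt (supp β).card + Real.sqrt (supp βhat).card) * W := by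
    have hs' := sum_abs_le_sqrt_card_mul (supp βhat) w
    have hsupp : ∑ j, |w j| ≤ ∑ j ∈ supp β, |w j| + ∑ j ∈ supp βhat, |w j| := by
      simp only [supp, Finset.sum_filter]
      rw [← Finset.sum_add_distrib]
      refine Finset.sum_le_sum fun j _ => ?_
      have := abs_nonneg (w j)
      by_cases h : β j = 0 <;> by_cases h' : βhat j = 0
      · simp [hwdef, h, h']
      all_goals
        simp only [ne_eq, h, h', not_true_eq_false, not_false_eq_true, if_true, if_false]
        linarith
    calc ∑ j, (∑ i, X i j * ε i) * w j ≤ ∑ j, M * |w j| := by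
          refine Finset.sum_le_sum fun j _ => (le_abs_self _).trans ?_
          rw [abs_mul]
          exact mul_le_mul_of_nonneg_right (hM j) (abs_nonneg _)
      _ = M * ∑ j, |w j| := by rw [Finset.mul_sum]
      _ ≤ M * (Real.sqrt (supp β).card * W + Real.sqrt (supp βhat).card * W) :=
          mul_le_mul_of_nonneg_left (hsupp.trans (add_le_add hs hs')) hM0
      _ = _ := by ring
  have hcross : -∑ j, β j * w j ≤ B * (Q * W) := by
    calc -∑ j, β j * w j ≤ ∑ j ∈ supp β, B * |w j| := by
          rw [← Finset.sum_neg_distrib, supp, Finset.sum_filter]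
          refine Finset.sum_le_sum fun j _ => ?_
          split_ifs with hj
          · refine (neg_le_abs _).trans ?_
            rw [abs_mul]
            exact mul_le_mul_of_nonneg_right (hB j (by simp [supp, hj])) (abs_nonneg _)
          · rw [not_not] at hj
            simp [hj]
      _ = B * ∑ j ∈ supp β, |w j| := by rw [Finset.mul_sum]
      _ ≤ B * (Q * W) :=
          mul_le_mul_of_nonneg_left (hs.trans (mul_le_mul_of_nonneg_right hsQ hW0)) hB0
  have hP₁ := mul_le_mul_of_nonneg_left (hpen₁.trans (mul_le_mul_of_nonneg_left
    (hs.trans (mul_le_mul_of_nonneg_right hsQ hW0)) hK0)) hρ1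
  have hP₂ := mul_le_mul_of_nonneg_left (hpen₂.trans (mul_le_mul_of_nonneg_left
    (sum_sqrt_card_mul_le (activeGroups G β) G hGdisj w) hK0)) hρ2
  have hR := mul_le_mul_of_nonneg_left hcross hlam
  set r := Real.sqrt (((supp βhat).card : ℝ) / (4 * (supp β).card)) with hrdef
  have hr0 : 0 ≤ r := Real.sqrt_nonneg _
  have hr : Real.sqrt (supp βhat).card ≤ 2 * (Q * r) := by
    rw [hrdef, sqrt_eq_two_mul_sqrt_mul_sqrt_div _ hs0]
    exact mul_le_mul_of_nonneg_left (mul_le_mul_of_nonneg_right hsQ hr0) zero_le_two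
  have hN : M * (Real.sqrt (supp β).card + Real.sqrt (supp βhat).card) * W ≤
      M * (2 * (Q * (1 + r))) * W :=
    mul_le_mul_of_nonneg_right (mul_le_mul_of_nonneg_left (by linarith) hM0) hW0
  have hmain : n * (κ + lam * (n : ℝ)⁻¹) * W ^ 2 ≤
      Q * (4 * (1 + r) * M + 2 * B * lam + K * (ρ1 + ρ2)) * W := by
    have hnD : n * (κ + lam * (n : ℝ)⁻¹) = n * κ + lam := by
      rw [mul_add, mul_left_comm, mul_inv_cancel₀ hn0.ne', mul_one]
    rw [hnD]
    simp only [mul_sub] at hP₁ hP₂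
    linarith
  clear_value r K
  clear hrdef hKdef
  exact le_div_mul_of_mul_sq_le hn0 hpos hQ0 (by positivity) hmain
end

section
/- Basic inequality for the penalized least-squares minimizer. Let β̂ be a minimizer of V_τ over ℝᵖ and set w = β̂ − β. Then wᵀ(XᵀX + λI)w ≤ 2wᵀ(Xᵀε − λβ) + ρ₁/log(1+τ⁻¹) · Σ_{j=1}^p [ log(1+τ⁻¹|β_j|) − log(1+τ⁻¹|β̂_j|) ] + ρ₂/log(1+τ⁻¹) · Σ_{k=1}^m √q_k [ log(1+τ⁻¹‖β_{G_k}‖₂) − log(1+τ⁻¹‖β̂_{G_k}‖₂) ]. -/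
/-- Expansion of the squared residual norm around a vector `β` in the direction `w`. -/
theorem sum_sq_residual_sub {ι κ : Type*} [Fintype ι] [Fintype κ] (X : Matrix ι κ ℝ)
    (ε : ι → ℝ) (w : κ → ℝ) :
    ∑ i, (ε i - ∑ j, X i j * w j) ^ 2
      = ∑ i, ε i ^ 2 - 2 * ∑ j, w j * ∑ i, X i j * ε i + ∑ i, (∑ j, X i j * w j) ^ 2 := by
  have hswap : ∑ j, w j * ∑ i, X i j * ε i = ∑ i, ε i * ∑ j, X i j * w j := by
    simp_rw [Finset.mul_sum]
    rw [Finset.sum_comm]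
    exact Finset.sum_congr rfl fun i _ => Finset.sum_congr rfl fun j _ => by ring
  rw [hswap, Finset.mul_sum, ← Finset.sum_sub_distrib, ← Finset.sum_add_distrib]
  exact Finset.sum_congr rfl fun i _ => by ring

/-- Expansion of the squared norm of `b` around `β`. -/
theorem sum_sq_eq_sum_sq_sub_add {κ : Type*} [Fintype κ] (b β : κ → ℝ) :
    ∑ j, b j ^ 2 = ∑ j, β j ^ 2 + 2 * ∑ j, (b j - β j) * β j + ∑ j, (b j - β j) ^ 2 := by
  rw [Finset.mul_sum, ← Finset.sum_add_distrib, ← Finset.sum_add_distrib]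
  exact Finset.sum_congr rfl fun j _ => by ring

/-- **Basic inequality for the penalized least-squares minimizer.**
If `β̂` minimizes `V_τ` over `ℝᵖ` and `w = β̂ − β`, `ε = y − Xβ`, then
`wᵀ(XᵀX + λI)w ≤ 2wᵀ(Xᵀε − λβ)
  + ρ₁/log(1+τ⁻¹) Σ_j [log(1+τ⁻¹|β_j|) − log(1+τ⁻¹|β̂_j|)]
  + ρ₂/log(1+τ⁻¹) Σ_k √q_k [log(1+τ⁻¹‖β_{G_k}‖₂) − log(1+τ⁻¹‖β̂_{G_k}‖₂)]`. -/
theorem basic_inequality_penalized_ls {n p m : ℕ}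
    (y : Fin n → ℝ) (X : Matrix (Fin n) (Fin p) ℝ) (β : Fin p → ℝ)
    (ε : Fin n → ℝ) (hε : ∀ i, ε i = y i - ∑ j, X i j * β j)
    (G : Fin m → Finset (Fin p))
    (hGne : ∀ k, (G k).Nonempty)
    (hGdisj : ∀ k k', k ≠ k' → Disjoint (G k) (G k'))
    (hGcover : ∀ j, ∃ k, j ∈ G k)
    (lam ρ1 ρ2 τ : ℝ) (hlam : 0 ≤ lam) (hρ1 : 0 ≤ ρ1) (hρ2 : 0 ≤ ρ2)
    (hτ : τ ∈ Set.Ioo (0 : ℝ) 1)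
    (βhat : Fin p → ℝ)
    (hmin : ∀ b : Fin p → ℝ, Vtau y X G lam ρ1 ρ2 τ βhat ≤ Vtau y X G lam ρ1 ρ2 τ b) :
    (∑ i, (∑ j, X i j * (βhat j - β j)) ^ 2) + lam * ∑ j, (βhat j - β j) ^ 2
      ≤ 2 * (∑ j, (βhat j - β j) * ((∑ i, X i j * ε i) - lam * β j))
        + ρ1 / Real.log (1 + τ⁻¹) *
            ∑ j, (Real.log (1 + τ⁻¹ * |β j|) - Real.log (1 + τ⁻¹ * |βhat j|))
        + ρ2 / Real.log (1 + τ⁻¹) *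
            ∑ k, Real.sqrt ((G k).card) *
              (Real.log (1 + τ⁻¹ * Real.sqrt (∑ j ∈ G k, (β j) ^ 2))
                - Real.log (1 + τ⁻¹ * Real.sqrt (∑ j ∈ G k, (βhat j) ^ 2))) := by
  have hresid : ∀ i, y i - ∑ j, X i j * βhat j = ε i - ∑ j, X i j * (βhat j - β j) := by
    intro i
    simp_rw [hε, mul_sub, Finset.sum_sub_distrib]
    ring
  have hcross : ∑ j, (βhat j - β j) * ((∑ i, X i j * ε i) - lam * β j)
      = ∑ j, (βhat j - β j) * ∑ i, X i j * ε i - lam * ∑ j, (βhat j - β j) * β j := by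
    rw [Finset.mul_sum, ← Finset.sum_sub_distrib]
    exact Finset.sum_congr rfl fun j _ => by ring
  have h := hmin β
  simp only [Vtau, hresid, ← hε] at h
  rw [sum_sq_residual_sub X ε fun j => βhat j - β j, sum_sq_eq_sum_sq_sub_add βhat β] at h
  simp only [← mul_div_assoc, ← Finset.sum_div] at h
  rw [hcross]
  simp only [mul_sub, Finset.sum_sub_distrib, div_mul_eq_mul_div] at h ⊢
  linarith
end

section
/- Log-ratio bound over the estimated support. Let β̂ ∈ ℝᵖ be arbitrary, w = β̂ − β, and assume S ≠ ∅ and Ŝ ≠ ∅. Then for every τ ∈ (0,1), Σ_{j∈Ŝ} log( (1 + τ⁻¹|β_j|)/(1 + τ⁻¹|β̂_j|) ) ≤ 2 c₂⁻¹ s^{1/2} ‖w‖₂, where c₂ = min_{j∈Ŝ}|β̂_j| and s = |S|. -/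
/-- The log-ratio of `1 + a|x|` to `1 + a|y|` is bounded by the relative error `|y - x| / |y|`. -/
theorem log_one_add_mul_abs_div_le {a : ℝ} (ha : 0 < a) (x : ℝ) {y : ℝ} (hy : y ≠ 0) :
    Real.log ((1 + a * |x|) / (1 + a * |y|)) ≤ |y|⁻¹ * |y - x| := by
  have hy' : 0 < |y| := abs_pos.mpr hy
  have hden : 0 < 1 + a * |y| := by positivity
  have htri : |x| - |y| ≤ |y - x| := by
    rw [abs_sub_comm]
    exact abs_sub_abs_le_abs_sub x y
  refine (Real.log_le_sub_one_of_pos (by positivity)).trans ?_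
  rw [inv_mul_eq_div, div_sub_one hden.ne', div_le_div_iff₀ hden hy']
  have h : a * |y| * (|x| - |y|) ≤ a * |y| * |y - x| :=
    mul_le_mul_of_nonneg_left htri (by positivity)
  nlinarith [abs_nonneg (y - x)]

/-- Cauchy–Schwarz: the `ℓ¹` norm on `s` is at most `√|s|` times the `ℓ²` norm. -/
theorem sum_abs_le_sqrt_card_mul_sqrt_sum_sq {ι : Type*} [Fintype ι] (s : Finset ι) (w : ι → ℝ) :
    ∑ j ∈ s, |w j| ≤ Real.sqrt s.card * Real.sqrt (∑ j, w j ^ 2) := by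
  rw [← Real.sqrt_mul (Nat.cast_nonneg _)]
  refine Real.le_sqrt_of_sq_le (sq_sum_le_card_mul_sum_sq.trans ?_)
  simp only [sq_abs]
  gcongr
  exact s.subset_univ

/-- **Log-ratio bound over the estimated support.**
For `β, β̂ ∈ ℝᵖ`, `w = β̂ − β`, `S = {j : β_j ≠ 0} ≠ ∅`, `Ŝ = {j : β̂_j ≠ 0} ≠ ∅`,
`c₂ = min_{j∈Ŝ} |β̂_j|` and `s = |S|`, for every `τ ∈ (0,1)`:
`Σ_{j∈Ŝ} log((1 + τ⁻¹|β_j|)/(1 + τ⁻¹|β̂_j|)) ≤ 2 c₂⁻¹ s^{1/2} ‖w‖₂`. -/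
theorem logRatio_bound_on_estimated_support {p : ℕ} (τ : ℝ) (hτ : τ ∈ Set.Ioo (0 : ℝ) 1)
    (β βhat : Fin p → ℝ)
    (hS : (Finset.univ.filter fun j => β j ≠ 0).Nonempty)
    (hShat : (Finset.univ.filter fun j => βhat j ≠ 0).Nonempty) :
    ∑ j ∈ Finset.univ.filter (fun j => βhat j ≠ 0),
        Real.log ((1 + τ⁻¹ * |β j|) / (1 + τ⁻¹ * |βhat j|))
      ≤ 2 * ((Finset.univ.filter fun j => βhat j ≠ 0).inf' hShat fun j => |βhat j|)⁻¹ *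
          Real.sqrt ((Finset.univ.filter fun j => β j ≠ 0).card) *
          Real.sqrt (∑ j, (βhat j - β j) ^ 2) := by
  have hτ' : 0 < τ⁻¹ := inv_pos.mpr hτ.1
  set c := (Finset.univ.filter fun j => βhat j ≠ 0).inf' hShat fun j => |βhat j|
  have hc : 0 < c := by
    rw [Finset.lt_inf'_iff]
    intro j hj
    exact abs_pos.mpr (Finset.mem_filter.mp hj).2
  have hterm : ∀ j ∈ Finset.univ.filter (fun j => βhat j ≠ 0),
      Real.log ((1 + τ⁻¹ * |β j|) / (1 + τ⁻¹ * |βhat j|)) ≤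
        if β j ≠ 0 then c⁻¹ * |βhat j - β j| else 0 := by
    intro j hj
    split_ifs with h
    · refine (log_one_add_mul_abs_div_le hτ' _ (Finset.mem_filter.mp hj).2).trans ?_
      have hcj : c ≤ |βhat j| := Finset.inf'_le _ hj
      gcongr
    · rw [not_not] at h
      rw [h, abs_zero, mul_zero, add_zero]
      have hnonneg : 0 ≤ τ⁻¹ * |βhat j| := by positivity
      exact Real.log_nonpos (by positivity)
        ((div_le_one (by positivity)).mpr (by linarith))
  calc _ ≤ ∑ j ∈ Finset.univ.filter (fun j => βhat j ≠ 0),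
          if β j ≠ 0 then c⁻¹ * |βhat j - β j| else 0 := Finset.sum_le_sum hterm
    _ ≤ ∑ j, if β j ≠ 0 then c⁻¹ * |βhat j - β j| else 0 :=
        Finset.sum_le_sum_of_subset_of_nonneg (Finset.subset_univ _) fun j _ _ => by
          split_ifs <;> positivity
    _ = c⁻¹ * ∑ j ∈ Finset.univ.filter (fun j => β j ≠ 0), |βhat j - β j| := by
        rw [← Finset.sum_filter, Finset.mul_sum]
    _ ≤ c⁻¹ * (Real.sqrt ((Finset.univ.filter fun j => β j ≠ 0).card) *
          Real.sqrt (∑ j, (βhat j - β j) ^ 2)) := by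
        gcongr
        exact sum_abs_le_sqrt_card_mul_sqrt_sum_sq _ fun j => βhat j - β j
    _ ≤ 2 * (c⁻¹ * (Real.sqrt ((Finset.univ.filter fun j => β j ≠ 0).card) *
          Real.sqrt (∑ j, (βhat j - β j) ^ 2))) :=
        le_mul_of_one_le_left (by positivity) one_le_two
    _ = _ := by ring
end

section
/- Combined coordinatewise log-sum penalty bound. Let β̂ ∈ ℝᵖ be arbitrary, w = β̂ − β, and assume S ≠ ∅ and Ŝ ≠ ∅. Then for every τ ∈ (0,1) and every ρ₁ ≥ 0, ρ₁ Σ_{j=1}^p [ log(1+τ⁻¹|β_j|)/log(1+τ⁻¹) − log(1+τ⁻¹|β̂_j|)/log(1+τ⁻¹) ] ≤ ρ₁ [ (2c₂⁻¹ + 1)/log(τ⁻¹) + c₃⁻¹ ] · s^{1/2} ‖w‖₂, where c₂ = min_{j∈Ŝ}|β̂_j|, c₃ = min_{j∈S}|β_j|, and s = |S|. -/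
/-- A logarithm increment is at most the increment of its argument over the smaller base point. -/
theorem log_one_add_mul_sub_log_le {t a b c : ℝ} (ht : 0 < t) (ha : 0 ≤ a) (hc : 0 < c)
    (hb : c ≤ b) :
    Real.log (1 + t * a) - Real.log (1 + t * b) ≤ |a - b| * c⁻¹ := by
  have hb0 : 0 < b := hc.trans_le hb
  have hA : 0 < 1 + t * a := by positivity
  have hB : 0 < 1 + t * b := by positivity
  rw [← Real.log_div hA.ne' hB.ne']
  refine (Real.log_le_sub_one_of_pos (div_pos hA hB)).trans ?_
  rw [← div_eq_mul_inv, div_sub_one hB.ne', div_le_div_iff₀ hB hc]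
  nlinarith [le_abs_self (a - b), abs_nonneg (a - b),
    mul_le_mul_of_nonneg_left hb (mul_nonneg ht.le (abs_nonneg (a - b))),
    mul_le_mul_of_nonneg_left (le_abs_self (a - b)) (mul_nonneg ht.le hc.le)]

/-- The product bound `1 + t * a ≤ (1 + t) * (1 + a)` in logarithmic form. -/
theorem log_one_add_mul_le {t a : ℝ} (ht : 0 < t) (ha : 0 ≤ a) :
    Real.log (1 + t * a) ≤ Real.log (1 + t) + a := by
  have h1 : Real.log (1 + a) ≤ a := by
    linarith [Real.log_le_sub_one_of_pos (show 0 < 1 + a by positivity)]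
  have h2 : Real.log (1 + t * a) ≤ Real.log ((1 + t) * (1 + a)) :=
    Real.log_le_log (by positivity) (by nlinarith)
  rw [Real.log_mul (by positivity) (by positivity)] at h2
  linarith

/-- Difference of log-sum penalties at two scalars `x ≠ 0` and `y`, where `d` bounds `|x|` from
below and `c` bounds `|y|` from below unless `y = 0`. -/
theorem logSum_penalty_sub_le {t c d x y : ℝ} (ht : 1 < t) (hc : 0 < c) (hd : 0 < d)
    (hx : d ≤ |x|) (hy : y ≠ 0 → c ≤ |y|) :
    Real.log (1 + t * |x|) / Real.log (1 + t) - Real.log (1 + t * |y|) / Real.log (1 + t)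
      ≤ ((2 * c⁻¹ + 1) / Real.log t + d⁻¹) * |y - x| := by
  have ht0 : 0 < t := one_pos.trans ht
  have hl : 0 < Real.log t := Real.log_pos ht
  have hlL : Real.log t ≤ Real.log (1 + t) := Real.log_le_log ht0 (by linarith)
  have hL : 0 < Real.log (1 + t) := hl.trans_le hlL
  rw [add_mul, div_mul_eq_mul_div]
  by_cases h : y = 0
  · subst h
    have h1 := log_one_add_mul_le ht0 (abs_nonneg x)
    have h2 : 1 ≤ d⁻¹ * |x| := by
      rw [inv_mul_eq_div, le_div_iff₀ hd]; linarith
    have h3 : |x| / Real.log (1 + t) ≤ (2 * c⁻¹ + 1) * |x| / Real.log t := by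
      have : 0 ≤ 2 * c⁻¹ * |x| := by positivity
      gcongr
      linarith
    have h4 : Real.log (1 + t * |x|) / Real.log (1 + t) ≤ 1 + |x| / Real.log (1 + t) := by
      rw [one_add_div hL.ne']
      gcongr
    simp only [abs_zero, mul_zero, add_zero, Real.log_one, zero_div, sub_zero, zero_sub, abs_neg]
    linarith
  · have h1 := log_one_add_mul_sub_log_le ht0 (abs_nonneg x) hc (hy h)
    have h2 : |(|x| - |y|)| ≤ |y - x| := by
      rw [abs_sub_comm y x]; exact abs_abs_sub_abs_le_abs_sub x y
    have h3 : |(|x| - |y|)| * c⁻¹ ≤ (2 * c⁻¹ + 1) * |y - x| := by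
      have : 0 ≤ c⁻¹ * |y - x| := by positivity
      have := mul_le_mul_of_nonneg_right h2 (inv_nonneg.2 hc.le)
      nlinarith [abs_nonneg (y - x)]
    have h4 : 0 ≤ d⁻¹ * |y - x| := by positivity
    have h5 : (Real.log (1 + t * |x|) - Real.log (1 + t * |y|)) / Real.log (1 + t)
        ≤ (2 * c⁻¹ + 1) * |y - x| / Real.log t := by
      have : 0 ≤ (2 * c⁻¹ + 1) * |y - x| := by positivity
      gcongr
      exact h1.trans h3
    rw [← sub_div]
    linarith

/-- Cauchy–Schwarz comparison of a partial `ℓ¹` norm with the `ℓ²` norm. -/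
theorem sum_abs_le_sqrt_card_mul_sqrt {ι : Type*} [Fintype ι] (s : Finset ι) (f : ι → ℝ) :
    ∑ j ∈ s, |f j| ≤ Real.sqrt s.card * Real.sqrt (∑ j, f j ^ 2) := by
  rw [← Real.sqrt_mul (Nat.cast_nonneg _)]
  refine Real.le_sqrt_of_sq_le ((sq_sum_le_card_mul_sum_sq (s := s)).trans ?_)
  simp only [sq_abs]
  gcongr
  exact Finset.subset_univ s


/-- **Combined coordinatewise log-sum penalty bound.**
For `β, β̂ ∈ ℝᵖ`, `w = β̂ − β`, `S = {j : β_j ≠ 0} ≠ ∅`, `Ŝ = {j : β̂_j ≠ 0} ≠ ∅`,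
`c₂ = min_{j∈Ŝ} |β̂_j|`, `c₃ = min_{j∈S} |β_j|` and `s = |S|`, for every `τ ∈ (0,1)` and
every `ρ₁ ≥ 0`:
`ρ₁ Σ_j [log(1+τ⁻¹|β_j|) − log(1+τ⁻¹|β̂_j|)]/log(1+τ⁻¹)
  ≤ ρ₁ [(2c₂⁻¹ + 1)/log(τ⁻¹) + c₃⁻¹] s^{1/2} ‖w‖₂`. -/
theorem coordinatewise_logSum_penalty_bound {p : ℕ} (τ ρ1 : ℝ)
    (hτ : τ ∈ Set.Ioo (0 : ℝ) 1) (hρ1 : 0 ≤ ρ1)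
    (β βhat : Fin p → ℝ)
    (hS : (Finset.univ.filter fun j => β j ≠ 0).Nonempty)
    (hShat : (Finset.univ.filter fun j => βhat j ≠ 0).Nonempty) :
    ρ1 * ∑ j, (Real.log (1 + τ⁻¹ * |β j|) / Real.log (1 + τ⁻¹)
          - Real.log (1 + τ⁻¹ * |βhat j|) / Real.log (1 + τ⁻¹))
      ≤ ρ1 * ((2 * ((Finset.univ.filter fun j => βhat j ≠ 0).inf' hShat fun j => |βhat j|)⁻¹ + 1)
              / Real.log τ⁻¹
            + ((Finset.univ.filter fun j => β j ≠ 0).inf' hS fun j => |β j|)⁻¹) *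
          Real.sqrt ((Finset.univ.filter fun j => β j ≠ 0).card) *
          Real.sqrt (∑ j, (βhat j - β j) ^ 2) := by
  have ht : 1 < τ⁻¹ := (one_lt_inv₀ hτ.1).2 hτ.2
  set S := Finset.univ.filter fun j => β j ≠ 0 with hSdef
  set T := Finset.univ.filter fun j => βhat j ≠ 0 with hTdef
  set c := T.inf' hShat fun j => |βhat j| with hcdef
  set d := S.inf' hS fun j => |β j| with hddef
  have hc : 0 < c := (Finset.lt_inf'_iff _).2 fun j hj => abs_pos.2 (by simpa [hTdef] using hj)
  have hd : 0 < d := (Finset.lt_inf'_iff _).2 fun j hj => abs_pos.2 (by simpa [hSdef] using hj)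
  have hL : 0 < Real.log (1 + τ⁻¹) := Real.log_pos (by linarith)
  have hl : 0 < Real.log τ⁻¹ := Real.log_pos ht
  rw [mul_assoc, mul_assoc]
  refine mul_le_mul_of_nonneg_left ?_ hρ1
  calc ∑ j, (Real.log (1 + τ⁻¹ * |β j|) / Real.log (1 + τ⁻¹)
          - Real.log (1 + τ⁻¹ * |βhat j|) / Real.log (1 + τ⁻¹))
      ≤ ∑ j, if β j ≠ 0 then
          ((2 * c⁻¹ + 1) / Real.log τ⁻¹ + d⁻¹) * |βhat j - β j| else 0 := by
        refine Finset.sum_le_sum fun j _ => ?_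
        split_ifs with h
        · exact logSum_penalty_sub_le ht hc hd
            (Finset.inf'_le (fun j => |β j|) (by simpa [hSdef] using h))
            fun h' => Finset.inf'_le (fun j => |βhat j|) (by simpa [hTdef] using h')
        · have h0 : 0 ≤ τ⁻¹ * |βhat j| := mul_nonneg (by linarith) (abs_nonneg _)
          have : 0 ≤ Real.log (1 + τ⁻¹ * |βhat j|) / Real.log (1 + τ⁻¹) :=
            div_nonneg (Real.log_nonneg (by linarith)) hL.le
          simpa [not_not.1 h] using this
    _ = ((2 * c⁻¹ + 1) / Real.log τ⁻¹ + d⁻¹) * ∑ j ∈ S, |βhat j - β j| := by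
        rw [← Finset.sum_filter, ← Finset.mul_sum]
    _ ≤ _ := mul_le_mul_of_nonneg_left
        (sum_abs_le_sqrt_card_mul_sqrt S fun j => βhat j - β j) (by positivity)
end

section
/- Groupwise log-ratio bound over the estimated active groups. Let β̂ ∈ ℝᵖ be arbitrary, w = β̂ − β, and assume S ≠ ∅ and Ŝ ≠ ∅. Let R̂ = {k : β̂_{G_k} ≠ 0}. Then for every τ ∈ (0,1), Σ_{k∈R̂} √q_k · log( (1 + τ⁻¹‖β_{G_k}‖₂)/(1 + τ⁻¹‖β̂_{G_k}‖₂) ) ≤ 2 c₂⁻¹ q_R^{1/2} ‖w‖₂, where c₂ = min_{j∈Ŝ}|β̂_j|, R = {k : β_{G_k} ≠ 0}, and q_R = Σ_{k∈R} q_k. -/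
/-- The triangle inequality for the Euclidean norm over a finite index set. -/
theorem sqrt_sum_sq_le_add_sqrt_sum_sq_sub {ι : Type*} (s : Finset ι) (f g : ι → ℝ) :
    √(∑ j ∈ s, f j ^ 2) ≤ √(∑ j ∈ s, g j ^ 2) + √(∑ j ∈ s, (g j - f j) ^ 2) := by
  have hg : 0 ≤ ∑ j ∈ s, g j ^ 2 := Finset.sum_nonneg fun _ _ => sq_nonneg _
  have hd : 0 ≤ ∑ j ∈ s, (g j - f j) ^ 2 := Finset.sum_nonneg fun _ _ => sq_nonneg _
  have hcs := Real.sum_mul_le_sqrt_mul_sqrt s g fun j => f j - g j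
  have hsymm : ∑ j ∈ s, (f j - g j) ^ 2 = ∑ j ∈ s, (g j - f j) ^ 2 :=
    Finset.sum_congr rfl fun _ _ => by ring
  rw [hsymm] at hcs
  have hexp : ∑ j ∈ s, f j ^ 2 =
      ∑ j ∈ s, g j ^ 2 + 2 * ∑ j ∈ s, g j * (f j - g j) + ∑ j ∈ s, (g j - f j) ^ 2 := by
    rw [Finset.mul_sum, ← Finset.sum_add_distrib, ← Finset.sum_add_distrib]
    exact Finset.sum_congr rfl fun _ _ => by ring
  refine Real.sqrt_le_iff.mpr ⟨by positivity, ?_⟩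
  rw [hexp, add_sq, Real.sq_sqrt hg, Real.sq_sqrt hd]
  linarith

/-- If `x ≤ y + d` and `c ≤ y`, then `log ((1 + t x) / (1 + t y)) ≤ d / c`. -/
theorem log_one_add_mul_div_le {t x y d c : ℝ} (ht : 0 < t) (hx : 0 ≤ x) (hd : 0 ≤ d)
    (hc : 0 < c) (hcy : c ≤ y) (hxy : x ≤ y + d) :
    Real.log ((1 + t * x) / (1 + t * y)) ≤ c⁻¹ * d := by
  have hy : 0 < y := hc.trans_le hcy
  refine (Real.log_le_sub_one_of_pos (by positivity)).trans ?_
  rw [sub_le_iff_le_add, div_le_iff₀ (by positivity)]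
  have h : d ≤ c⁻¹ * d * y := by
    rw [inv_mul_eq_div, div_mul_eq_mul_div, le_div_iff₀ hc]
    gcongr
  have h' : 0 ≤ c⁻¹ * d := by positivity
  nlinarith [mul_le_mul_of_nonneg_left hxy ht.le, mul_le_mul_of_nonneg_left h ht.le]


/-- **Groupwise log-ratio bound over the estimated active groups.**
Let `G₁,…,G_m` partition `{1,…,p}` into nonempty groups with `q_k = |G_k|`.
For `β, β̂ ∈ ℝᵖ`, `w = β̂ − β`, `S ≠ ∅`, `Ŝ ≠ ∅`, `R̂ = {k : β̂_{G_k} ≠ 0}`,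
`c₂ = min_{j∈Ŝ} |β̂_j|`, `R = {k : β_{G_k} ≠ 0}` and `q_R = Σ_{k∈R} q_k`, for every
`τ ∈ (0,1)`:
`Σ_{k∈R̂} √q_k log((1 + τ⁻¹‖β_{G_k}‖₂)/(1 + τ⁻¹‖β̂_{G_k}‖₂)) ≤ 2 c₂⁻¹ q_R^{1/2} ‖w‖₂`. -/
theorem groupwise_logRatio_bound_active {p m : ℕ} (τ : ℝ) (hτ : τ ∈ Set.Ioo (0 : ℝ) 1)
    (G : Fin m → Finset (Fin p))
    (hGne : ∀ k, (G k).Nonempty)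
    (hGdisj : ∀ k k', k ≠ k' → Disjoint (G k) (G k'))
    (hGcover : ∀ j, ∃ k, j ∈ G k)
    (β βhat : Fin p → ℝ)
    (hS : (Finset.univ.filter fun j => β j ≠ 0).Nonempty)
    (hShat : (Finset.univ.filter fun j => βhat j ≠ 0).Nonempty) :
    ∑ k ∈ Finset.univ.filter (fun k => ∃ j ∈ G k, βhat j ≠ 0),
        Real.sqrt ((G k).card) *
          Real.log ((1 + τ⁻¹ * Real.sqrt (∑ j ∈ G k, (β j) ^ 2))
              / (1 + τ⁻¹ * Real.sqrt (∑ j ∈ G k, (βhat j) ^ 2)))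
      ≤ 2 * ((Finset.univ.filter fun j => βhat j ≠ 0).inf' hShat fun j => |βhat j|)⁻¹ *
          Real.sqrt (∑ k ∈ Finset.univ.filter (fun k => ∃ j ∈ G k, β j ≠ 0), ((G k).card : ℝ)) *
          Real.sqrt (∑ j, (βhat j - β j) ^ 2) := by
  classical
  set c := (Finset.univ.filter fun j => βhat j ≠ 0).inf' hShat fun j => |βhat j| with hc_def
  set R := Finset.univ.filter (fun k => ∃ j ∈ G k, β j ≠ 0) with hR_def
  have ht : 0 < τ⁻¹ := inv_pos.mpr hτ.1
  have hc : 0 < c := by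
    rw [hc_def, Finset.lt_inf'_iff]
    intro j hj
    exact abs_pos.mpr (Finset.mem_filter.mp hj).2
  have hterm : ∀ k ∈ Finset.univ.filter (fun k => ∃ j ∈ G k, βhat j ≠ 0),
      √((G k).card) * Real.log ((1 + τ⁻¹ * √(∑ j ∈ G k, (β j) ^ 2))
        / (1 + τ⁻¹ * √(∑ j ∈ G k, (βhat j) ^ 2))) ≤
      if k ∈ R then c⁻¹ * (√((G k).card) * √(∑ j ∈ G k, (βhat j - β j) ^ 2)) else 0 := by
    intro k hk
    obtain ⟨j, hjG, hj⟩ := (Finset.mem_filter.mp hk).2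
    split_ifs with hkR
    · have hcj : c ≤ |βhat j| :=
        Finset.inf'_le (fun j => |βhat j|) (Finset.mem_filter.mpr ⟨Finset.mem_univ j, hj⟩)
      have hjn : |βhat j| ≤ √(∑ j ∈ G k, (βhat j) ^ 2) :=
        Real.abs_le_sqrt (Finset.single_le_sum (f := fun j => (βhat j) ^ 2)
          (fun _ _ => sq_nonneg _) hjG)
      rw [mul_left_comm]
      exact mul_le_mul_of_nonneg_left
        (log_one_add_mul_div_le ht (Real.sqrt_nonneg _) (Real.sqrt_nonneg _) hc
          (hcj.trans hjn) (sqrt_sum_sq_le_add_sqrt_sum_sq_sub _ _ _)) (Real.sqrt_nonneg _)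
    · have hzero : ∑ j ∈ G k, (β j) ^ 2 = 0 := by
        refine Finset.sum_eq_zero fun i hi => ?_
        by_contra hne
        exact hkR (Finset.mem_filter.mpr
          ⟨Finset.mem_univ _, i, hi, fun h => hne (by simp [h])⟩)
      rw [hzero, Real.sqrt_zero, mul_zero, add_zero]
      refine mul_nonpos_of_nonneg_of_nonpos (Real.sqrt_nonneg _)
        (Real.log_nonpos (by positivity) (div_le_one_of_le₀ ?_ (by positivity)))
      exact le_add_of_nonneg_right (by positivity)
  have hgroups : ∑ k ∈ R, ∑ j ∈ G k, (βhat j - β j) ^ 2 ≤ ∑ j, (βhat j - β j) ^ 2 := by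
    rw [← Finset.sum_biUnion fun k _ k' _ hkk' => hGdisj k k' hkk']
    exact Finset.sum_le_sum_of_subset_of_nonneg (Finset.subset_univ _)
      fun _ _ _ => sq_nonneg _
  have hcs : ∑ k ∈ R, √((G k).card) * √(∑ j ∈ G k, (βhat j - β j) ^ 2) ≤
      √(∑ k ∈ R, ((G k).card : ℝ)) * √(∑ j, (βhat j - β j) ^ 2) :=
    (Real.sum_sqrt_mul_sqrt_le R (fun _ => Nat.cast_nonneg _)
      fun _ => Finset.sum_nonneg fun _ _ => sq_nonneg _).trans
      (mul_le_mul_of_nonneg_left (Real.sqrt_le_sqrt hgroups) (Real.sqrt_nonneg _))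
  calc _ ≤ _ := Finset.sum_le_sum hterm
    _ ≤ ∑ k, if k ∈ R then c⁻¹ * (√((G k).card) * √(∑ j ∈ G k, (βhat j - β j) ^ 2)) else 0 :=
      Finset.sum_le_sum_of_subset_of_nonneg (Finset.subset_univ _) fun k _ _ => by
        split_ifs <;> positivity
    _ = c⁻¹ * ∑ k ∈ R, √((G k).card) * √(∑ j ∈ G k, (βhat j - β j) ^ 2) := by
      rw [Finset.sum_ite_mem, Finset.univ_inter, Finset.mul_sum]
    _ ≤ c⁻¹ * (√(∑ k ∈ R, ((G k).card : ℝ)) * √(∑ j, (βhat j - β j) ^ 2)) :=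
      mul_le_mul_of_nonneg_left hcs (inv_pos.mpr hc).le
    _ ≤ 2 * c⁻¹ * √(∑ k ∈ R, ((G k).card : ℝ)) * √(∑ j, (βhat j - β j) ^ 2) := by
      have : 0 ≤ c⁻¹ * (√(∑ k ∈ R, ((G k).card : ℝ)) * √(∑ j, (βhat j - β j) ^ 2)) := by
        positivity
      linarith
end

section
/- Groupwise log-difference bound over the estimated inactive groups. Let β̂ ∈ ℝᵖ be arbitrary, w = β̂ − β, and assume S ≠ ∅. Let R̂ = {k : β̂_{G_k} ≠ 0}. Then for every τ ∈ (0,1), Σ_{k∉R̂} √q_k [ log(1 + τ⁻¹‖β_{G_k}‖₂) − log(1 + τ⁻¹‖β̂_{G_k}‖₂) ] ≤ [1 + c₃⁻¹ log(τ⁻¹)] · q_R^{1/2} ‖w‖₂, where c₃ = min_{j∈S}|β_j|, R = {k : β_{G_k} ≠ 0}, and q_R = Σ_{k∈R} q_k. (For k ∉ R̂ one has β̂_{G_k} = 0, so the summand is √q_k log(1+τ⁻¹‖β_{G_k}‖₂).) -/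
/-- For `0 < c ≤ x` and `0 < τ < 1`, the logarithm `log (1 + x / τ)` is at most linear in `x`. -/
theorem Real.log_one_add_inv_mul_le {τ c x : ℝ} (hτ0 : 0 < τ) (hτ1 : τ < 1) (hc : 0 < c)
    (hcx : c ≤ x) : Real.log (1 + τ⁻¹ * x) ≤ (1 + c⁻¹ * Real.log τ⁻¹) * x := by
  have hx : 0 < x := hc.trans_le hcx
  have hL : 0 ≤ Real.log τ⁻¹ := Real.log_nonneg ((one_le_inv₀ hτ0).2 hτ1.le)
  have hsplit : Real.log (1 + τ⁻¹ * x) = Real.log τ⁻¹ + Real.log (τ + x) := by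
    rw [← Real.log_mul (by positivity) (by positivity)]
    congr 1
    field_simp
  have hlog : Real.log (τ + x) ≤ x := by
    linarith [Real.log_le_sub_one_of_pos (show 0 < τ + x by positivity)]
  have hone : 1 ≤ c⁻¹ * x := by
    rw [inv_mul_eq_div]
    exact (one_le_div hc).2 hcx
  nlinarith [mul_le_mul_of_nonneg_right hone hL]

/-- Cauchy–Schwarz over a family of disjoint groups. -/
theorem sum_sqrt_card_mul_sqrt_sum_sq_le {ι κ : Type*} [Fintype ι] [DecidableEq ι]
    (G : κ → Finset ι) (hG : ∀ k k', k ≠ k' → Disjoint (G k) (G k')) (R : Finset κ)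
    (w : ι → ℝ) :
    ∑ k ∈ R, Real.sqrt ((G k).card) * Real.sqrt (∑ j ∈ G k, w j ^ 2)
      ≤ Real.sqrt (∑ k ∈ R, ((G k).card : ℝ)) * Real.sqrt (∑ j, w j ^ 2) := by
  refine (Real.sum_sqrt_mul_sqrt_le R (fun k => Nat.cast_nonneg _)
    fun k => Finset.sum_nonneg fun j _ => sq_nonneg _).trans ?_
  gcongr
  rw [← Finset.sum_biUnion fun k _ k' _ h => hG k k' h]
  exact Finset.sum_le_sum_of_subset_of_nonneg (Finset.subset_univ _) fun j _ _ => sq_nonneg _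


/-- **Groupwise log-difference bound over the estimated inactive groups.**
Let `G₁,…,G_m` partition `{1,…,p}` into nonempty groups with `q_k = |G_k|`.
For `β, β̂ ∈ ℝᵖ`, `w = β̂ − β`, `S ≠ ∅`, `R̂ = {k : β̂_{G_k} ≠ 0}`,
`c₃ = min_{j∈S} |β_j|`, `R = {k : β_{G_k} ≠ 0}` and `q_R = Σ_{k∈R} q_k`, for every
`τ ∈ (0,1)`:
`Σ_{k∉R̂} √q_k [log(1 + τ⁻¹‖β_{G_k}‖₂) − log(1 + τ⁻¹‖β̂_{G_k}‖₂)]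
  ≤ [1 + c₃⁻¹ log(τ⁻¹)] q_R^{1/2} ‖w‖₂`. -/
theorem groupwise_logDiff_bound_inactive {p m : ℕ} (τ : ℝ) (hτ : τ ∈ Set.Ioo (0 : ℝ) 1)
    (G : Fin m → Finset (Fin p))
    (hGne : ∀ k, (G k).Nonempty)
    (hGdisj : ∀ k k', k ≠ k' → Disjoint (G k) (G k'))
    (hGcover : ∀ j, ∃ k, j ∈ G k)
    (β βhat : Fin p → ℝ)
    (hS : (Finset.univ.filter fun j => β j ≠ 0).Nonempty) :
    ∑ k ∈ Finset.univ.filter (fun k => ¬ ∃ j ∈ G k, βhat j ≠ 0),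
        Real.sqrt ((G k).card) *
          (Real.log (1 + τ⁻¹ * Real.sqrt (∑ j ∈ G k, (β j) ^ 2))
            - Real.log (1 + τ⁻¹ * Real.sqrt (∑ j ∈ G k, (βhat j) ^ 2)))
      ≤ (1 + ((Finset.univ.filter fun j => β j ≠ 0).inf' hS fun j => |β j|)⁻¹ *
            Real.log τ⁻¹) *
          Real.sqrt (∑ k ∈ Finset.univ.filter (fun k => ∃ j ∈ G k, β j ≠ 0), ((G k).card : ℝ)) *
          Real.sqrt (∑ j, (βhat j - β j) ^ 2) := by
  obtain ⟨hτ0, hτ1⟩ := hτ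
  set c := (Finset.univ.filter fun j => β j ≠ 0).inf' hS fun j => |β j| with hc
  have hcpos : 0 < c := by
    rw [hc, Finset.lt_inf'_iff]
    intro j hj
    exact abs_pos.2 (Finset.mem_filter.1 hj).2
  have hC : 0 ≤ 1 + c⁻¹ * Real.log τ⁻¹ := by
    have := Real.log_nonneg ((one_le_inv₀ hτ0).2 hτ1.le)
    positivity
  rw [mul_assoc]
  refine le_trans ?_ (mul_le_mul_of_nonneg_left
    (sum_sqrt_card_mul_sqrt_sum_sq_le G hGdisj _ fun j => βhat j - β j) hC)
  rw [Finset.mul_sum, Finset.sum_filter, Finset.sum_filter]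
  refine Finset.sum_le_sum fun k _ => ?_
  by_cases hR : ∃ j ∈ G k, β j ≠ 0
  · rw [if_pos hR]
    split_ifs with hk
    · positivity
    · push Not at hk
      have hw : ∑ j ∈ G k, (βhat j - β j) ^ 2 = ∑ j ∈ G k, β j ^ 2 :=
        Finset.sum_congr rfl fun j hj => by rw [hk j hj]; ring
      have hz : ∑ j ∈ G k, βhat j ^ 2 = 0 :=
        Finset.sum_eq_zero fun j hj => by rw [hk j hj]; ring
      have hcx : c ≤ Real.sqrt (∑ j ∈ G k, β j ^ 2) := by
        obtain ⟨j, hj, hβ⟩ := hR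
        refine (Finset.inf'_le _ (by simpa using hβ)).trans (Real.abs_le_sqrt ?_)
        exact Finset.single_le_sum (f := fun j => β j ^ 2) (fun i _ => sq_nonneg _) hj
      rw [hw, hz, Real.sqrt_zero, mul_zero, add_zero, Real.log_one, sub_zero, mul_left_comm]
      gcongr
      exact Real.log_one_add_inv_mul_le hτ0 hτ1 hcpos hcx
  · rw [if_neg hR]
    split_ifs with hk
    · exact le_rfl
    · push Not at hk hR
      have hz : ∑ j ∈ G k, βhat j ^ 2 = ∑ j ∈ G k, β j ^ 2 :=
        Finset.sum_congr rfl fun j hj => by rw [hk j hj, hR j hj]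
      rw [hz, sub_self, mul_zero]
end

section
/- Combined groupwise log-sum penalty bound. Let β̂ ∈ ℝᵖ be arbitrary, w = β̂ − β, and assume S ≠ ∅ and Ŝ ≠ ∅. Then for every τ ∈ (0,1) and every ρ₂ ≥ 0, ρ₂ Σ_{k=1}^m √q_k [ log(1+τ⁻¹‖β_{G_k}‖₂)/log(1+τ⁻¹) − log(1+τ⁻¹‖β̂_{G_k}‖₂)/log(1+τ⁻¹) ] ≤ ρ₂ [ (2c₂⁻¹ + 1)/log(τ⁻¹) + c₃⁻¹ ] · q_R^{1/2} ‖w‖₂, where c₂ = min_{j∈Ŝ}|β̂_j|, c₃ = min_{j∈S}|β_j|, R = {k : β_{G_k} ≠ 0}, and q_R = Σ_{k∈R} q_k. -/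
/-- Increments of the normalized log-sum penalty are linearly bounded, provided the second argument
is either zero or bounded away from zero. -/
theorem log_div_sub_log_div_le {τ a b c₂ c₃ d : ℝ} (hτ : 0 < τ) (hτ1 : τ < 1) (hc₂ : 0 < c₂)
    (hc₃ : 0 < c₃) (ha : c₃ ≤ a) (hb0 : 0 ≤ b) (hb : b = 0 ∨ c₂ ≤ b) (hd : 0 ≤ d)
    (had : a ≤ b + d) :
    Real.log (1 + τ⁻¹ * a) / Real.log (1 + τ⁻¹) - Real.log (1 + τ⁻¹ * b) / Real.log (1 + τ⁻¹)
      ≤ ((2 * c₂⁻¹ + 1) / Real.log τ⁻¹ + c₃⁻¹) * d := by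
  have hτi : 0 < τ⁻¹ := inv_pos.2 hτ
  have hℓ : 0 < Real.log τ⁻¹ := Real.log_pos ((one_lt_inv₀ hτ).2 hτ1)
  have hℓL : Real.log τ⁻¹ ≤ Real.log (1 + τ⁻¹) := Real.log_le_log hτi (by linarith)
  have hL : 0 < Real.log (1 + τ⁻¹) := hℓ.trans_le hℓL
  have ha0 : 0 < a := hc₃.trans_le ha
  have hc₂i : 0 < c₂⁻¹ := inv_pos.2 hc₂
  have hc₃i : 0 < c₃⁻¹ := inv_pos.2 hc₃
  rcases hb with rfl | hb
  · have had' : a ≤ d := by linarith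
    have h1 : Real.log (1 + τ⁻¹ * a) ≤ Real.log (1 + τ⁻¹) + a := by
      have h := Real.log_le_log (by positivity)
        (show 1 + τ⁻¹ * a ≤ (1 + τ⁻¹) * (1 + a) by nlinarith)
      rw [Real.log_mul (by positivity) (by positivity)] at h
      have := Real.log_le_sub_one_of_pos (show 0 < 1 + a by linarith)
      linarith
    have h2 : Real.log (1 + τ⁻¹ * a) / Real.log (1 + τ⁻¹) ≤ 1 + d / Real.log τ⁻¹ :=
      calc Real.log (1 + τ⁻¹ * a) / Real.log (1 + τ⁻¹)
          ≤ (Real.log (1 + τ⁻¹) + a) / Real.log (1 + τ⁻¹) := by gcongr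
        _ = 1 + a / Real.log (1 + τ⁻¹) := by rw [add_div, div_self hL.ne']
        _ ≤ 1 + d / Real.log τ⁻¹ := by gcongr
    have h3 : 1 ≤ c₃⁻¹ * d := by
      rw [inv_mul_eq_div, one_le_div hc₃]
      linarith
    have h4 : 0 ≤ 2 * c₂⁻¹ * (d / Real.log τ⁻¹) := by positivity
    have h5 : ((2 * c₂⁻¹ + 1) / Real.log τ⁻¹ + c₃⁻¹) * d
        = 2 * c₂⁻¹ * (d / Real.log τ⁻¹) + d / Real.log τ⁻¹ + c₃⁻¹ * d := by ring
    simp only [mul_zero, add_zero, Real.log_one, zero_div, sub_zero]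
    linarith
  · have hb' : 0 < b := hc₂.trans_le hb
    have h1 : Real.log (1 + τ⁻¹ * a) ≤ Real.log (1 + τ⁻¹ * b) + c₂⁻¹ * d := by
      have hbd : d ≤ b * (c₂⁻¹ * d) := by
        have : 1 ≤ c₂⁻¹ * b := by rwa [inv_mul_eq_div, one_le_div hc₂]
        nlinarith
      have h := Real.log_le_log (by positivity)
        (show 1 + τ⁻¹ * a ≤ (1 + τ⁻¹ * b) * (1 + c₂⁻¹ * d) by
          have h₁ : τ⁻¹ * a ≤ τ⁻¹ * (b + b * (c₂⁻¹ * d)) := by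
            gcongr
            linarith
          have h₂ : 0 ≤ c₂⁻¹ * d := by positivity
          linarith)
      rw [Real.log_mul (by positivity) (by positivity)] at h
      have := Real.log_le_sub_one_of_pos (show 0 < 1 + c₂⁻¹ * d by positivity)
      linarith
    rw [← sub_div]
    calc (Real.log (1 + τ⁻¹ * a) - Real.log (1 + τ⁻¹ * b)) / Real.log (1 + τ⁻¹)
        ≤ (c₂⁻¹ * d) / Real.log (1 + τ⁻¹) := by
          gcongr
          linarith
      _ ≤ (c₂⁻¹ * d) / Real.log τ⁻¹ := by gcongr
      _ = (c₂⁻¹ / Real.log τ⁻¹) * d := by ring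
      _ ≤ ((2 * c₂⁻¹ + 1) / Real.log τ⁻¹ + c₃⁻¹) * d := by
          have : c₂⁻¹ / Real.log τ⁻¹ ≤ (2 * c₂⁻¹ + 1) / Real.log τ⁻¹ := by
            gcongr
            linarith
          gcongr
          linarith

/-- The triangle inequality for the Euclidean norm on a finite set of coordinates. -/
theorem sqrt_sum_sq_le_add_sqrt_sum_sub_sq {ι : Type*} (s : Finset ι) (f g : ι → ℝ) :
    Real.sqrt (∑ j ∈ s, f j ^ 2)
      ≤ Real.sqrt (∑ j ∈ s, g j ^ 2) + Real.sqrt (∑ j ∈ s, (g j - f j) ^ 2) := by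
  have hcs := Real.sum_mul_le_sqrt_mul_sqrt s g (fun j => f j - g j)
  have hsymm : ∑ j ∈ s, (f j - g j) ^ 2 = ∑ j ∈ s, (g j - f j) ^ 2 :=
    Finset.sum_congr rfl fun j _ => by ring
  have hexp : ∑ j ∈ s, f j ^ 2
      = ∑ j ∈ s, g j ^ 2 + 2 * ∑ j ∈ s, g j * (f j - g j) + ∑ j ∈ s, (g j - f j) ^ 2 := by
    rw [Finset.mul_sum, ← Finset.sum_add_distrib, ← Finset.sum_add_distrib]
    exact Finset.sum_congr rfl fun j _ => by ring
  rw [hsymm] at hcs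
  have hg := Real.sq_sqrt (Finset.sum_nonneg fun j (_ : j ∈ s) => sq_nonneg (g j))
  have hgf := Real.sq_sqrt (Finset.sum_nonneg fun j (_ : j ∈ s) => sq_nonneg (g j - f j))
  refine Real.sqrt_le_iff.2 ⟨by positivity, ?_⟩
  rw [hexp, add_sq, hg, hgf]
  linarith

/-- The modulus of a coordinate is at most the Euclidean norm. -/
theorem abs_le_sqrt_sum_sq {ι : Type*} {s : Finset ι} (f : ι → ℝ) {j : ι} (hj : j ∈ s) :
    |f j| ≤ Real.sqrt (∑ i ∈ s, f i ^ 2) :=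
  Real.abs_le_sqrt (Finset.single_le_sum (f := fun i => f i ^ 2) (fun _ _ => sq_nonneg _) hj)

/-- **Combined groupwise log-sum penalty bound.**
Let `G₁,…,G_m` partition `{1,…,p}` into nonempty groups with `q_k = |G_k|`.
For `β, β̂ ∈ ℝᵖ`, `w = β̂ − β`, `S ≠ ∅`, `Ŝ ≠ ∅`, `c₂ = min_{j∈Ŝ} |β̂_j|`,
`c₃ = min_{j∈S} |β_j|`, `R = {k : β_{G_k} ≠ 0}` and `q_R = Σ_{k∈R} q_k`, for every
`τ ∈ (0,1)` and `ρ₂ ≥ 0`: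
`ρ₂ Σ_k √q_k [log(1+τ⁻¹‖β_{G_k}‖₂) − log(1+τ⁻¹‖β̂_{G_k}‖₂)]/log(1+τ⁻¹)
  ≤ ρ₂ [(2c₂⁻¹ + 1)/log(τ⁻¹) + c₃⁻¹] q_R^{1/2} ‖w‖₂`. -/
theorem groupwise_logSum_penalty_bound {p m : ℕ} (τ ρ2 : ℝ)
    (hτ : τ ∈ Set.Ioo (0 : ℝ) 1) (hρ2 : 0 ≤ ρ2)
    (G : Fin m → Finset (Fin p))
    (hGne : ∀ k, (G k).Nonempty)
    (hGdisj : ∀ k k', k ≠ k' → Disjoint (G k) (G k'))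
    (hGcover : ∀ j, ∃ k, j ∈ G k)
    (β βhat : Fin p → ℝ)
    (hS : (Finset.univ.filter fun j => β j ≠ 0).Nonempty)
    (hShat : (Finset.univ.filter fun j => βhat j ≠ 0).Nonempty) :
    ρ2 * ∑ k, Real.sqrt ((G k).card) *
        (Real.log (1 + τ⁻¹ * Real.sqrt (∑ j ∈ G k, (β j) ^ 2)) / Real.log (1 + τ⁻¹)
          - Real.log (1 + τ⁻¹ * Real.sqrt (∑ j ∈ G k, (βhat j) ^ 2)) / Real.log (1 + τ⁻¹))
      ≤ ρ2 * ((2 * ((Finset.univ.filter fun j => βhat j ≠ 0).inf' hShat fun j => |βhat j|)⁻¹ + 1)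
              / Real.log τ⁻¹
            + ((Finset.univ.filter fun j => β j ≠ 0).inf' hS fun j => |β j|)⁻¹) *
          Real.sqrt (∑ k ∈ Finset.univ.filter (fun k => ∃ j ∈ G k, β j ≠ 0), ((G k).card : ℝ)) *
          Real.sqrt (∑ j, (βhat j - β j) ^ 2) := by
  obtain ⟨hτ0, hτ1⟩ := hτ
  set c₂ := (Finset.univ.filter fun j => βhat j ≠ 0).inf' hShat fun j => |βhat j|
  set c₃ := (Finset.univ.filter fun j => β j ≠ 0).inf' hS fun j => |β j|
  set R := Finset.univ.filter (fun k => ∃ j ∈ G k, β j ≠ 0) with hR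
  have hc₂ : 0 < c₂ := (Finset.lt_inf'_iff _).2 fun j hj => abs_pos.2 (Finset.mem_filter.1 hj).2
  have hc₃ : 0 < c₃ := (Finset.lt_inf'_iff _).2 fun j hj => abs_pos.2 (Finset.mem_filter.1 hj).2
  have hc₂_le : ∀ j, βhat j ≠ 0 → c₂ ≤ |βhat j| := fun j hj =>
    Finset.inf'_le _ (Finset.mem_filter.2 ⟨Finset.mem_univ j, hj⟩)
  have hc₃_le : ∀ j, β j ≠ 0 → c₃ ≤ |β j| := fun j hj =>
    Finset.inf'_le _ (Finset.mem_filter.2 ⟨Finset.mem_univ j, hj⟩)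
  have hτi : 1 < τ⁻¹ := (one_lt_inv₀ hτ0).2 hτ1
  have hℓ : 0 < Real.log τ⁻¹ := Real.log_pos hτi
  set K := (2 * c₂⁻¹ + 1) / Real.log τ⁻¹ + c₃⁻¹
  have hK0 : 0 ≤ K := by positivity
  rw [mul_assoc, mul_assoc]
  refine mul_le_mul_of_nonneg_left ?_ hρ2
  set T : Fin m → ℝ := fun k => Real.sqrt ((G k).card) *
    (Real.log (1 + τ⁻¹ * Real.sqrt (∑ j ∈ G k, (β j) ^ 2)) / Real.log (1 + τ⁻¹)
      - Real.log (1 + τ⁻¹ * Real.sqrt (∑ j ∈ G k, (βhat j) ^ 2)) / Real.log (1 + τ⁻¹))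
  have h_inactive : ∀ k, k ∉ R → T k ≤ 0 := by
    intro k hk
    have hzero : ∀ j ∈ G k, β j = 0 := by
      simpa [hR] using hk
    have hsum : ∑ j ∈ G k, β j ^ 2 = 0 :=
      Finset.sum_eq_zero fun j hj => by rw [hzero j hj, zero_pow two_ne_zero]
    have hlog : 0 ≤ Real.log (1 + τ⁻¹ * Real.sqrt (∑ j ∈ G k, (βhat j) ^ 2)) :=
      Real.log_nonneg (le_add_of_nonneg_right (by positivity))
    have hL : 0 ≤ Real.log (1 + τ⁻¹) := Real.log_nonneg (by linarith)
    refine mul_nonpos_of_nonneg_of_nonpos (Real.sqrt_nonneg _) ?_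
    rw [hsum, Real.sqrt_zero, mul_zero, add_zero, Real.log_one, zero_div, zero_sub]
    exact neg_nonpos.2 (div_nonneg hlog hL)
  have h_active : ∀ k ∈ R, T k ≤
      K * (Real.sqrt ((G k).card) * Real.sqrt (∑ j ∈ G k, (βhat j - β j) ^ 2)) := by
    intro k hk
    obtain ⟨j, hj, hβj⟩ := (Finset.mem_filter.1 hk).2
    have hb : Real.sqrt (∑ j ∈ G k, (βhat j) ^ 2) = 0 ∨
        c₂ ≤ Real.sqrt (∑ j ∈ G k, (βhat j) ^ 2) := by
      by_cases h : ∃ i ∈ G k, βhat i ≠ 0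
      · obtain ⟨i, hi, hβi⟩ := h
        exact Or.inr ((hc₂_le i hβi).trans (abs_le_sqrt_sum_sq βhat hi))
      · push Not at h
        left
        rw [Finset.sum_eq_zero fun i hi => by rw [h i hi, zero_pow two_ne_zero], Real.sqrt_zero]
    have h := log_div_sub_log_div_le hτ0 hτ1 hc₂ hc₃
      ((hc₃_le j hβj).trans (abs_le_sqrt_sum_sq β hj)) (Real.sqrt_nonneg _) hb
      (Real.sqrt_nonneg _) (sqrt_sum_sq_le_add_sqrt_sum_sub_sq (G k) β βhat)
    rw [mul_left_comm]
    exact mul_le_mul_of_nonneg_left h (Real.sqrt_nonneg _)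
  have h_groups : ∑ k ∈ R, ∑ j ∈ G k, (βhat j - β j) ^ 2 ≤ ∑ j, (βhat j - β j) ^ 2 := by
    rw [← Finset.sum_biUnion fun k _ k' _ hkk' => hGdisj k k' hkk']
    exact Finset.sum_le_sum_of_subset_of_nonneg (Finset.subset_univ _) fun _ _ _ => sq_nonneg _
  calc ∑ k, T k
      ≤ ∑ k ∈ R, T k := by
        rw [← Finset.sum_add_sum_compl R T]
        exact add_le_of_nonpos_right
          (Finset.sum_nonpos fun k hk => h_inactive k (Finset.mem_compl.1 hk))
    _ ≤ K * ∑ k ∈ R, Real.sqrt ((G k).card) * Real.sqrt (∑ j ∈ G k, (βhat j - β j) ^ 2) := by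
        rw [Finset.mul_sum]
        exact Finset.sum_le_sum h_active
    _ ≤ K * (Real.sqrt (∑ k ∈ R, ((G k).card : ℝ)) *
          Real.sqrt (∑ k ∈ R, ∑ j ∈ G k, (βhat j - β j) ^ 2)) := by
        gcongr
        exact Real.sum_sqrt_mul_sqrt_le _ (fun _ => Nat.cast_nonneg _)
          fun _ => Finset.sum_nonneg fun _ _ => sq_nonneg _
    _ ≤ K * (Real.sqrt (∑ k ∈ R, ((G k).card : ℝ)) *
          Real.sqrt (∑ j, (βhat j - β j) ^ 2)) := by
        gcongr
end

section
/- Bound on the linear term. Let β̂ ∈ ℝᵖ be arbitrary, w = β̂ − β, and assume S ≠ ∅. Then for any n×p matrix X, any ε ∈ ℝⁿ and any λ ≥ 0, 2wᵀ(Xᵀε − λβ) ≤ 2 s^{1/2}[2 + (ŝ/s)^{1/2}] ‖w‖₂ ‖Xᵀε‖_∞ + 2λ s^{1/2} max_{j∈S}|β_j| · ‖w‖₂, where s = |S|, ŝ = |Ŝ|, and ‖Xᵀε‖_∞ = max_{1≤j≤p} |(Xᵀε)_j|. -/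
/-- Cauchy–Schwarz for a sum supported on `T`, with one factor bounded on `T`. -/
lemma sum_mul_le_sqrt_card_mul {ι : Type*} [Fintype ι] (T : Finset ι) (w a : ι → ℝ) {B : ℝ}
    (hB : 0 ≤ B) (ha : ∀ j ∈ T, |a j| ≤ B) (hT : ∀ j, j ∉ T → w j * a j = 0) :
    ∑ j, w j * a j ≤ Real.sqrt T.card * B * Real.sqrt (∑ j, w j ^ 2) := by
  have hsq : ∑ j ∈ T, a j ^ 2 ≤ T.card * B ^ 2 := by
    rw [← nsmul_eq_mul]
    exact Finset.sum_le_card_nsmul _ _ _ fun j hj => sq_le_sq' (abs_le.1 (ha j hj)).1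
      (abs_le.1 (ha j hj)).2
  calc ∑ j, w j * a j = ∑ j ∈ T, w j * a j :=
        (Finset.sum_subset (Finset.subset_univ T) fun j _ hj => hT j hj).symm
    _ ≤ Real.sqrt (∑ j ∈ T, w j ^ 2) * Real.sqrt (∑ j ∈ T, a j ^ 2) :=
        Real.sum_mul_le_sqrt_mul_sqrt _ _ _
    _ ≤ Real.sqrt (∑ j, w j ^ 2) * Real.sqrt (T.card * B ^ 2) := by
        gcongr
        exact Finset.subset_univ T
    _ = Real.sqrt T.card * B * Real.sqrt (∑ j, w j ^ 2) := by
        rw [Real.sqrt_mul (Nat.cast_nonneg _), Real.sqrt_sq hB]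
        ring

/-- The square root of the cardinality of a union is subadditive, in scaled form. -/
lemma sqrt_card_union_le {ι : Type*} [DecidableEq ι] (S T : Finset ι) (hS : S.Nonempty) :
    Real.sqrt (S ∪ T).card ≤ Real.sqrt S.card * (1 + Real.sqrt ((T.card : ℝ) / S.card)) := by
  have hs : (0 : ℝ) < S.card := by exact_mod_cast hS.card_pos
  have h : ((S ∪ T).card : ℝ) ≤ S.card + T.card := by exact_mod_cast Finset.card_union_le S T
  have hmul : Real.sqrt S.card * Real.sqrt ((T.card : ℝ) / S.card) = Real.sqrt T.card := by
    rw [← Real.sqrt_mul hs.le, mul_div_cancel₀ _ hs.ne']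
  rw [mul_add, mul_one, hmul]
  refine Real.sqrt_le_iff.2 ⟨by positivity, h.trans ?_⟩
  nlinarith [Real.sq_sqrt hs.le, Real.sq_sqrt (Nat.cast_nonneg (α := ℝ) T.card),
    mul_nonneg (Real.sqrt_nonneg S.card) (Real.sqrt_nonneg T.card)]


/-- **Bound on the linear term.**
For `β, β̂ ∈ ℝᵖ` with `w = β̂ − β`, `S = {j : β_j ≠ 0} ≠ ∅`, `Ŝ = {j : β̂_j ≠ 0}`,
`s = |S|`, `ŝ = |Ŝ|`, any `n × p` matrix `X`, any `ε ∈ ℝⁿ` and any `λ ≥ 0`: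
`2wᵀ(Xᵀε − λβ) ≤ 2 s^{1/2} [2 + (ŝ/s)^{1/2}] ‖w‖₂ ‖Xᵀε‖_∞
  + 2λ s^{1/2} max_{j∈S} |β_j| ‖w‖₂`. -/
theorem linear_term_bound {n p : ℕ} (X : Matrix (Fin n) (Fin p) ℝ) (ε : Fin n → ℝ)
    (lam : ℝ) (hlam : 0 ≤ lam) (β βhat : Fin p → ℝ)
    (hS : (Finset.univ.filter fun j => β j ≠ 0).Nonempty) :
    2 * ∑ j, (βhat j - β j) * ((∑ i, X i j * ε i) - lam * β j)
      ≤ 2 * Real.sqrt ((Finset.univ.filter fun j => β j ≠ 0).card) *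
          (2 + Real.sqrt (((Finset.univ.filter fun j => βhat j ≠ 0).card : ℝ)
              / ((Finset.univ.filter fun j => β j ≠ 0).card : ℝ))) *
          Real.sqrt (∑ j, (βhat j - β j) ^ 2) *
          (Finset.univ.sup' ⟨hS.choose, Finset.mem_univ _⟩ fun j => |∑ i, X i j * ε i|)
        + 2 * lam * Real.sqrt ((Finset.univ.filter fun j => β j ≠ 0).card) *
            ((Finset.univ.filter fun j => β j ≠ 0).sup' hS fun j => |β j|) *
            Real.sqrt (∑ j, (βhat j - β j) ^ 2) := by
  set S := Finset.univ.filter fun j => β j ≠ 0 with hSdef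
  set T := Finset.univ.filter fun j => βhat j ≠ 0 with hTdef
  set M := Finset.univ.sup' ⟨hS.choose, Finset.mem_univ _⟩ fun j => |∑ i, X i j * ε i|
  set B := S.sup' hS fun j => |β j|
  set W := Real.sqrt (∑ j, (βhat j - β j) ^ 2)
  have hW : 0 ≤ W := Real.sqrt_nonneg _
  have hM : ∀ j, |∑ i, X i j * ε i| ≤ M := fun j =>
    Finset.le_sup' (fun j => |∑ i, X i j * ε i|) (Finset.mem_univ j)
  have hM0 : 0 ≤ M := (abs_nonneg _).trans (hM hS.choose)
  have hB : ∀ j ∈ S, |β j| ≤ B := fun j hj => Finset.le_sup' (fun j => |β j|) hj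
  have hB0 : 0 ≤ B := (abs_nonneg _).trans (hB _ hS.choose_spec)
  have hnoise : ∑ j, (βhat j - β j) * ∑ i, X i j * ε i
      ≤ Real.sqrt (S ∪ T).card * M * W := by
    refine sum_mul_le_sqrt_card_mul (S ∪ T) (fun j => βhat j - β j) _ hM0
      (fun j _ => hM j) fun j hj => ?_
    have h : β j = 0 ∧ βhat j = 0 := by simpa [hSdef, hTdef] using hj
    simp [h.1, h.2]
  have hbias : ∑ j, (βhat j - β j) * -β j ≤ Real.sqrt S.card * B * W := by
    refine sum_mul_le_sqrt_card_mul S (fun j => βhat j - β j) (fun j => -β j) hB0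
      (fun j hj => by simpa using hB j hj) fun j hj => ?_
    have h : β j = 0 := by simpa [hSdef] using hj
    simp [h]
  have hsplit : ∑ j, (βhat j - β j) * ((∑ i, X i j * ε i) - lam * β j)
      = ∑ j, (βhat j - β j) * ∑ i, X i j * ε i + lam * ∑ j, (βhat j - β j) * -β j := by
    rw [Finset.mul_sum, ← Finset.sum_add_distrib]
    exact Finset.sum_congr rfl fun j _ => by ring
  have hcard : Real.sqrt (S ∪ T).card
      ≤ Real.sqrt S.card * (2 + Real.sqrt ((T.card : ℝ) / S.card)) :=
    (sqrt_card_union_le S T hS).trans (by gcongr; norm_num)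
  have hunion := mul_le_mul_of_nonneg_right hcard (mul_nonneg hM0 hW)
  have hscaled := mul_le_mul_of_nonneg_left hbias hlam
  rw [hsplit]
  linarith
end
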